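/- Let μ, ν be partitions, set k = μ_1 + ν_1 and l = length(μ) + length(ν), and let A = (((k^l)/μ)°)/ν be the skew diagram obtained from the rectangle (k^l) by removing ν from the top-left and μ rotated 180° from the bottom-right. Then the union of all partitions η with c(η; μ, ν) ≠ 0 (the cover partition of the ordinary product [μ] ⊗ [ν]) equals the complement in (k^l) of the base partition B([A]): its i-th part is k − B([A])_{l+1−i}. -/

import Mathlib

/-- `f : ℕ → ℕ` represents a partition (0-indexed parts): weakly decreasing
and eventually zero. -/
def IsPartition (f : ℕ → ℕ) : Prop :=
  (∀ ⦃i j : ℕ⦄, i ≤ j → f j ≤ f i) ∧ ∃ N, ∀ i, N ≤ i → f i = 0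

/-- The box `(i, j)` (row `i`, column `j`, both 0-indexed) lies in the skew
diagram `l / m`. -/
def InSkew (l m : ℕ → ℕ) (p : ℕ × ℕ) : Prop :=
  m p.1 ≤ p.2 ∧ p.2 < l p.1

/-- `T` is a Littlewood–Richardson tableau of skew shape `l / m` and content `n`:
entries are positive exactly on the shape, rows weakly increase, columns strictly
increase, the number of entries equal to `k + 1` is `n k`, and every prefix of the
reverse reading word (right to left, top to bottom) is a lattice word. -/
structure IsLR (l m n : ℕ → ℕ) (T : ℕ → ℕ → ℕ) : Prop where
  support : ∀ p : ℕ × ℕ, T p.1 p.2 ≠ 0 ↔ InSkew l m p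
  row_weak : ∀ i j, InSkew l m (i, j) → InSkew l m (i, j + 1) → T i j ≤ T i (j + 1)
  col_strict : ∀ i j, InSkew l m (i, j) → InSkew l m (i + 1, j) → T i j < T (i + 1) j
  content : ∀ k : ℕ, Nat.card {p : ℕ × ℕ // T p.1 p.2 = k + 1} = n k
  lattice : ∀ i j k : ℕ,
    Nat.card {p : ℕ × ℕ // T p.1 p.2 = k + 2 ∧ (p.1 < i ∨ (p.1 = i ∧ j ≤ p.2))} ≤
      Nat.card {p : ℕ × ℕ // T p.1 p.2 = k + 1 ∧ (p.1 < i ∨ (p.1 = i ∧ j ≤ p.2))}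

/-- The Littlewood–Richardson coefficient `c(l; m, n)`: the number of LR tableaux
of shape `l / m` and content `n`. -/
noncomputable def LR (l m n : ℕ → ℕ) : ℕ :=
  Nat.card {T : ℕ → ℕ → ℕ // IsLR l m n T}

/-- The partition `a` is contained in the skew diagram `l / m`: some translate
of `a`, or of `a` rotated by 180°, is a subset of the diagram. -/
def ContainedIn (a l m : ℕ → ℕ) : Prop :=
  (∃ r c, ∀ i j, j < a i → InSkew l m (r + i, c + j)) ∨
  (∃ r c, ∀ i j, j < a i → i ≤ r ∧ j ≤ c ∧ InSkew l m (r - i, c - j))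

/-- The complement of `f` in the rectangle with `L` rows of length `k`,
rotated by 180°, regarded as a partition. -/
def RotCompl (k L : ℕ) (f : ℕ → ℕ) : ℕ → ℕ :=
  fun i => if i < L then k - f (L - 1 - i) else 0


open Finset in
/-- counting a prefix of the reading word row by row -/
theorem prefix_count (T : ℕ → ℕ → ℕ) (W : ℕ) (hW : ∀ r c, T r c ≠ 0 → c < W) (i j w : ℕ) :
    Nat.card {p : ℕ × ℕ // T p.1 p.2 = w + 1 ∧ (p.1 < i ∨ (p.1 = i ∧ j ≤ p.2))} =
      ∑ s ∈ range i, #{c ∈ range W | T s c = w + 1} +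
        #{c ∈ range W | T i c = w + 1 ∧ j ≤ c} := by
  classical
  rw [Nat.subtype_card (((range (i+1)) ×ˢ (range W)).filter
    (fun p => T p.1 p.2 = w + 1 ∧ (p.1 < i ∨ (p.1 = i ∧ j ≤ p.2))))]
  · rw [card_filter, sum_product, sum_range_succ]
    congr 1
    · apply sum_congr rfl
      intro s hs
      rw [card_filter]
      apply sum_congr rfl
      intro c _
      have := mem_range.1 hs
      simp [this]
    · rw [card_filter]
      apply sum_congr rfl
      intro c _
      simp
  · rintro ⟨r, c⟩
    simp only [mem_filter, mem_product, mem_range]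
    constructor
    · exact fun h => h.2
    · intro h
      refine ⟨⟨by omega, hW r c (by omega)⟩, h⟩

open Finset in
theorem total_count (T : ℕ → ℕ → ℕ) (W L : ℕ) (hW : ∀ r c, T r c ≠ 0 → c < W)
    (hL : ∀ r c, T r c ≠ 0 → r < L) (w : ℕ) :
    Nat.card {p : ℕ × ℕ // T p.1 p.2 = w + 1} =
      ∑ s ∈ range L, #{c ∈ range W | T s c = w + 1} := by
  classical
  rw [Nat.subtype_card (((range L) ×ˢ (range W)).filter (fun p => T p.1 p.2 = w + 1))]
  · rw [card_filter, sum_product]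
    apply sum_congr rfl
    intro s hs
    rw [card_filter]
  · rintro ⟨r, c⟩
    simp only [mem_filter, mem_product, mem_range]
    constructor
    · exact fun h => h.2
    · intro h
      exact ⟨⟨hL r c (by omega), hW r c (by omega)⟩, h⟩

/-- Gelfand-Tsetlin style encoding: `P r v` is the end of the entries `≤ v` in row `r`. -/
structure Pat (L : ℕ) (l m n : ℕ → ℕ) (P : ℕ → ℕ → ℕ) : Prop where
  zero : ∀ r, P r 0 = m r
  top : ∀ r v, r < v → P r v = l r
  mono : ∀ r v, P r v ≤ P r (v + 1)
  inter : ∀ r v, P (r + 1) (v + 1) ≤ P r v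
  latt : ∀ i v, ∑ s ∈ Finset.range (i + 1), P s (v + 2) + ∑ s ∈ Finset.range i, P s v ≤
    ∑ s ∈ Finset.range (i + 1), P s (v + 1) + ∑ s ∈ Finset.range i, P s (v + 1)
  cont : ∀ v, ∑ s ∈ Finset.range L, P s (v + 1) = ∑ s ∈ Finset.range L, P s v + n v
  lz : ∀ r, L ≤ r → l r = 0

theorem Pat.monotone {L : ℕ} {l m n : ℕ → ℕ} {P : ℕ → ℕ → ℕ} (h : Pat L l m n P) (r : ℕ) :
    Monotone (P r) := monotone_nat_of_le_succ (h.mono r)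

theorem Pat.le_top {L : ℕ} {l m n : ℕ → ℕ} {P : ℕ → ℕ → ℕ} (h : Pat L l m n P) (r v : ℕ) :
    P r v ≤ l r := by
  rw [← h.top r (max v (r+1)) (by omega)]
  exact h.monotone r (le_max_left _ _)

/-- the tableau of a pattern -/
def patT (l m : ℕ → ℕ) (P : ℕ → ℕ → ℕ) (r c : ℕ) : ℕ :=
  if m r ≤ c ∧ c < l r then ((Finset.range (r + 1)).filter (fun v => P r v ≤ c)).card else 0

theorem patT_iff {L : ℕ} {l m n : ℕ → ℕ} {P : ℕ → ℕ → ℕ} (h : Pat L l m n P) (r c w : ℕ) :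
    patT l m P r c = w + 1 ↔ P r w ≤ c ∧ c < P r (w + 1) := by
  have hex : (m r ≤ c ∧ c < l r) → ∃ u, u < r + 1 ∧ P r u ≤ c ∧ c < P r (u+1) := by
    rintro ⟨h1, h2⟩
    have hE : ∃ u, c < P r u := ⟨r+1, by rw [h.top r _ (by omega)]; exact h2⟩
    classical
    have h3 := Nat.find_spec hE
    have h0 : Nat.find hE ≠ 0 := by
      intro h0
      rw [h0, h.zero] at h3
      omega
    obtain ⟨u, hu⟩ := Nat.exists_eq_succ_of_ne_zero h0
    have h4 := Nat.find_min hE (m := u) (by omega)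
    have h5 : Nat.find hE ≤ r + 1 := Nat.find_min' hE (by rw [h.top r _ (by omega)]; exact h2)
    rw [hu] at h3
    exact ⟨u, by omega, by omega, h3⟩
  have key : ∀ u, u < r + 1 → P r u ≤ c → c < P r (u+1) → 
      ((Finset.range (r + 1)).filter (fun v => P r v ≤ c)).card = u + 1 := by
    intro u hu h1 h2
    have : (Finset.range (r + 1)).filter (fun v => P r v ≤ c) = Finset.range (u+1) := by
      ext v
      simp only [Finset.mem_filter, Finset.mem_range]
      constructor
      · rintro ⟨_, hv⟩
        by_contra hc
        have := h.monotone r (show u + 1 ≤ v by omega)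
        omega
      · intro hv
        have := h.monotone r (show v ≤ u by omega)
        exact ⟨by omega, by omega⟩
    rw [this, Finset.card_range]
  unfold patT
  constructor
  · intro h1
    split_ifs at h1 with h2
    obtain ⟨u, hu, h3, h4⟩ := hex h2
    rw [key u hu h3 h4] at h1
    have : u = w := by omega
    subst this
    exact ⟨h3, h4⟩
  · rintro ⟨h1, h2⟩
    have h3 : m r ≤ c := by
      rw [← h.zero]; exact (h.monotone r (Nat.zero_le w)).trans h1
    have h4 : c < l r := lt_of_lt_of_le h2 (h.le_top _ _)
    rw [if_pos ⟨h3, h4⟩]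
    have : w < r + 1 := by
      by_contra hc
      rw [h.top r w (by omega)] at h1
      omega
    exact key w this h1 h2

theorem patT_ne {L : ℕ} {l m n : ℕ → ℕ} {P : ℕ → ℕ → ℕ} (h : Pat L l m n P) (r c : ℕ) :
    patT l m P r c ≠ 0 ↔ m r ≤ c ∧ c < l r := by
  constructor
  · intro h1
    by_contra hc
    exact h1 (by unfold patT; rw [if_neg hc])
  · intro h1
    unfold patT
    rw [if_pos h1]
    apply Nat.pos_iff_ne_zero.1
    rw [Finset.card_pos]
    exact ⟨0, by simp [h.zero, h1.1]⟩

theorem patT_row {L : ℕ} {l m n : ℕ → ℕ} {P : ℕ → ℕ → ℕ} (h : Pat L l m n P) (W : ℕ)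
    (hW : ∀ r, l r ≤ W) (r w : ℕ) :
    ((Finset.range W).filter (fun c => patT l m P r c = w + 1)).card + P r w = P r (w + 1) := by
  have : (Finset.range W).filter (fun c => patT l m P r c = w + 1) =
      Finset.Ico (P r w) (P r (w+1)) := by
    ext c
    simp only [Finset.mem_filter, Finset.mem_range, Finset.mem_Ico, patT_iff h]
    constructor
    · exact fun h => h.2
    · intro h1
      have := h.le_top r (w+1)
      have := hW r
      exact ⟨by omega, h1⟩
  rw [this, Nat.card_Ico]
  have := h.mono r w
  omega

theorem Pat.isLR {L : ℕ} {l m n : ℕ → ℕ} {P : ℕ → ℕ → ℕ} (h : Pat L l m n P)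
    (hl : ∀ ⦃i j : ℕ⦄, i ≤ j → l j ≤ l i) : IsLR l m n (patT l m P) := by
  have hW : ∀ r c, patT l m P r c ≠ 0 → c < l 0 := by
    intro r c hc
    rw [patT_ne h] at hc
    have := hl (Nat.zero_le r)
    omega
  have hL : ∀ r c, patT l m P r c ≠ 0 → r < L := by
    intro r c hc
    rw [patT_ne h] at hc
    by_contra hr
    have := h.lz r (by omega)
    omega
  have hrow := patT_row h (l 0) (fun r => hl (Nat.zero_le r))
  have hsum : ∀ i w, ∑ s ∈ Finset.range i,
      ((Finset.range (l 0)).filter (fun c => patT l m P s c = w + 1)).card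
      + ∑ s ∈ Finset.range i, P s w = ∑ s ∈ Finset.range i, P s (w + 1) := by
    intro i w
    rw [← Finset.sum_add_distrib]
    exact Finset.sum_congr rfl (fun s _ => hrow s w)
  refine ⟨?_, ?_, ?_, ?_, ?_⟩
  · rintro ⟨r, c⟩
    exact patT_ne h r c
  · intro r c h1 h2
    have h3 := (patT_ne h r c).2 h1
    have h4 := (patT_ne h r (c+1)).2 h2
    obtain ⟨u, hu⟩ := Nat.exists_eq_succ_of_ne_zero h3
    obtain ⟨w, hw⟩ := Nat.exists_eq_succ_of_ne_zero h4
    have h5 := (patT_iff h r c u).1 hu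
    have h6 := (patT_iff h r (c+1) w).1 hw
    rw [hu, hw]
    by_contra hc
    have := h.monotone r (show w + 1 ≤ u by omega)
    omega
  · intro r c h1 h2
    have h3 := (patT_ne h r c).2 h1
    have h4 := (patT_ne h (r+1) c).2 h2
    obtain ⟨u, hu⟩ := Nat.exists_eq_succ_of_ne_zero h3
    obtain ⟨w, hw⟩ := Nat.exists_eq_succ_of_ne_zero h4
    have h5 := (patT_iff h r c u).1 hu
    have h6 := (patT_iff h (r+1) c w).1 hw
    rw [hu, hw]
    by_contra hc
    have := h.monotone r (show w ≤ u by omega)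
    have := h.inter r w
    omega
  · intro k
    rw [total_count _ (l 0) L hW hL]
    have := hsum L k
    have := h.cont k
    omega
  · intro i j k
    rw [show k + 2 = (k + 1) + 1 from rfl, prefix_count _ (l 0) hW, prefix_count _ (l 0) hW]
    have h1 := hsum (i+1) (k+1)
    have h2 := hsum i k
    rw [Finset.sum_range_succ] at h1
    have h3 := h.latt i k
    have h4 : ((Finset.range (l 0)).filter (fun c => patT l m P i c = k + 1 + 1 ∧ j ≤ c)).card ≤
        ((Finset.range (l 0)).filter (fun c => patT l m P i c = k + 1 + 1)).card := by
      apply Finset.card_le_card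
      intro c
      simp only [Finset.mem_filter]
      tauto
    simp only [show k + 1 + 1 = k + 2 from rfl] at *
    omega

section ext
variable {l m n : ℕ → ℕ} {T : ℕ → ℕ → ℕ}

theorem IsLR.row_mono (h : IsLR l m n T) (r c d : ℕ) (hcd : c ≤ d) (hc : T r c ≠ 0)
    (hd : T r d ≠ 0) : T r c ≤ T r d := by
  induction d, hcd using Nat.le_induction with
  | base => exact le_rfl
  | succ d hcd ih =>
    have h1 := (h.support (r, c)).1 hc
    have h2 := (h.support (r, d+1)).1 hd
    have h3 : InSkew l m (r, d) := by
      simp only [InSkew] at *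
      omega
    exact (ih ((h.support (r, d)).2 h3)).trans (h.row_weak r d h3 h2)

theorem IsLR.le_row (h : IsLR l m n T) (hl : ∀ ⦃i j : ℕ⦄, i ≤ j → l j ≤ l i) :
    ∀ r c, T r c ≤ r + 1 := by
  have hW : ∀ r c, T r c ≠ 0 → c < l 0 := by
    intro r c hc
    have h1 := (h.support (r, c)).1 hc
    have := hl (Nat.zero_le r)
    simp only [InSkew] at h1
    omega
  intro r
  induction r using Nat.strong_induction_on with
  | _ r ih =>
    intro c
    by_contra hc
    obtain ⟨k, hk⟩ : ∃ k, T r c = k + 2 := ⟨T r c - 2, by omega⟩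
    have h1 := h.lattice r c k
    have h2 : 0 < Nat.card {p : ℕ × ℕ // T p.1 p.2 = k + 2 ∧ (p.1 < r ∨ (p.1 = r ∧ c ≤ p.2))} := by
      rw [show k + 2 = (k+1)+1 from rfl, prefix_count T (l 0) hW]
      apply Nat.add_pos_right
      rw [Finset.card_pos]
      exact ⟨c, by simp [hk, hW r c (by omega)]⟩
    have h3 := lt_of_lt_of_le h2 h1
    obtain ⟨⟨⟨⟨p, q⟩, h4, h5⟩⟩, _⟩ := Nat.card_pos_iff.1 h3
    simp only at h4 h5
    rcases h5 with h5 | ⟨rfl, h5⟩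
    · have := ih p h5 q
      omega
    · have := h.row_mono p c q h5 (by omega) (by omega)
      omega

theorem IsLR.toPat (h : IsLR l m n T) (hl : ∀ ⦃i j : ℕ⦄, i ≤ j → l j ≤ l i)
    (hm : ∀ ⦃i j : ℕ⦄, i ≤ j → m j ≤ m i) (hml : ∀ r, m r ≤ l r) (L : ℕ)
    (hL : ∀ r, L ≤ r → l r = 0) : ∃ P, Pat L l m n P := by
  have hsup : ∀ r c, T r c ≠ 0 ↔ m r ≤ c ∧ c < l r := fun r c => h.support (r, c)
  have hW : ∀ r c, T r c ≠ 0 → c < l 0 := by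
    intro r c hc
    have h1 := (hsup r c).1 hc
    have := hl (Nat.zero_le r)
    omega
  have hLT : ∀ r c, T r c ≠ 0 → r < L := by
    intro r c hc
    have h1 := (hsup r c).1 hc
    by_contra hr
    have := hL r (by omega)
    omega
  have hle := h.le_row hl
  set A : ℕ → ℕ → ℕ := fun s w => ((Finset.range (l 0)).filter (fun c => T s c = w + 1)).card with hA
  set P : ℕ → ℕ → ℕ := fun r v => m r + ((Finset.Ico (m r) (l r)).filter (fun c => T r c ≤ v)).card
    with hP
  have hPl : ∀ r v, P r v ≤ l r := by
    intro r v
    have := Finset.card_filter_le (Finset.Ico (m r) (l r)) (fun c => T r c ≤ v)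
    rw [Nat.card_Ico] at this
    have := hml r
    simp only [hP]
    omega
  -- the entries at most v form an initial segment
  have hiff : ∀ r v c, m r ≤ c → c < l r → (T r c ≤ v ↔ c < P r v) := by
    intro r v c h1 h2
    constructor
    · intro h3
      have : Finset.Ico (m r) (c+1) ⊆ (Finset.Ico (m r) (l r)).filter (fun c => T r c ≤ v) := by
        intro d
        simp only [Finset.mem_Ico, Finset.mem_filter]
        rintro ⟨h4, h5⟩
        refine ⟨⟨h4, by omega⟩, ?_⟩
        exact (h.row_mono r d c (by omega) ((hsup r d).2 ⟨h4, by omega⟩) 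
          ((hsup r c).2 ⟨h1, h2⟩)).trans h3
      have := Finset.card_le_card this
      rw [Nat.card_Ico] at this
      simp only [hP]
      omega
    · intro h3
      by_contra h4
      have : (Finset.Ico (m r) (l r)).filter (fun c => T r c ≤ v) ⊆ Finset.Ico (m r) c := by
        intro d
        simp only [Finset.mem_Ico, Finset.mem_filter]
        rintro ⟨⟨h5, h6⟩, h7⟩
        refine ⟨h5, ?_⟩
        by_contra h8
        have := h.row_mono r c d (by omega) ((hsup r c).2 ⟨h1, h2⟩) ((hsup r d).2 ⟨h5, h6⟩)
        omega
      have := Finset.card_le_card this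
      rw [Nat.card_Ico] at this
      simp only [hP] at h3
      omega
  have hstep : ∀ r v, P r (v+1) = P r v + A r v := by
    intro r v
    simp only [hP, hA]
    rw [add_assoc]
    congr 1
    rw [← Finset.card_union_of_disjoint]
    · congr 1
      ext c
      simp only [Finset.mem_union, Finset.mem_filter, Finset.mem_Ico, Finset.mem_range]
      constructor
      · rintro ⟨h1, h2⟩
        rcases Nat.lt_or_ge v (T r c) with h3 | h3
        · exact Or.inr ⟨hW r c (by omega), by omega⟩
        · exact Or.inl ⟨h1, h3⟩
      · rintro (⟨h1, h2⟩ | ⟨h1, h2⟩)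
        · exact ⟨h1, by omega⟩
        · exact ⟨(hsup r c).1 (by omega), by omega⟩
    · rw [Finset.disjoint_left]
      intro c
      simp only [Finset.mem_filter]
      rintro ⟨_, h1⟩ ⟨_, h2⟩
      omega
  have hsum : ∀ i v, ∑ s ∈ Finset.range i, P s (v+1) = 
      ∑ s ∈ Finset.range i, P s v + ∑ s ∈ Finset.range i, A s v := by
    intro i v
    rw [← Finset.sum_add_distrib]
    exact Finset.sum_congr rfl (fun s _ => hstep s v)
  refine ⟨P, ?_, ?_, ?_, ?_, ?_, ?_, hL⟩
  · intro r
    simp only [hP]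
    rw [Finset.filter_false_of_mem]
    · simp
    · intro c hc
      rw [Finset.mem_Ico] at hc
      have := (hsup r c).2 hc
      omega
  · intro r v hv
    simp only [hP]
    rw [Finset.filter_true_of_mem]
    · rw [Nat.card_Ico]
      have := hml r
      omega
    · intro c hc
      have := hle r c
      omega
  · intro r v
    rw [hstep]
    omega
  · intro r v
    by_contra hc
    have h1 := hPl (r+1) (v+1)
    have h2 := hl (Nat.le_succ r)
    have h3 := hm (Nat.le_succ r)
    have h4 : m r ≤ P r v := Nat.le_add_right _ _
    simp only [Nat.succ_eq_add_one] at *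
    have h5 := (hiff (r+1) (v+1) (P r v) (by omega) (by omega)).2 (by omega)
    have h6 := mt (hiff r v (P r v) (by omega) (by omega)).1 (by omega)
    have h7 := h.col_strict r (P r v) ⟨by simpa using h4, by simp only; omega⟩ ⟨by simp only; omega, by simp only; omega⟩
    omega
  · intro i v
    rw [show v + 2 = (v+1)+1 from rfl, hsum (i+1) (v+1), hsum i v]
    have h1 := h.lattice i (P i (v+1)) v
    rw [show v + 2 = (v+1)+1 from rfl, prefix_count T (l 0) hW, prefix_count T (l 0) hW] at h1
    have h2 : (Finset.range (l 0)).filter (fun c => T i c = v + 1 ∧ P i (v+1) ≤ c) = ∅ := by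
      apply Finset.filter_false_of_mem
      rintro c - ⟨h3, h4⟩
      have h5 := (hsup i c).1 (by omega)
      have := (hiff i (v+1) c h5.1 h5.2).1 (by omega)
      omega
    have h3 : (Finset.range (l 0)).filter (fun c => T i c = v + 1 + 1 ∧ P i (v+1) ≤ c) = 
        (Finset.range (l 0)).filter (fun c => T i c = v + 1 + 1) := by
      apply Finset.filter_congr
      intro c _
      constructor
      · exact fun h => h.1
      · intro h4
        refine ⟨h4, ?_⟩
        have h5 := (hsup i c).1 (by omega)
        have := mt (hiff i (v+1) c h5.1 h5.2).2 (by omega)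
        omega
    rw [h2, h3] at h1
    rw [Finset.sum_range_succ (fun s => A s (v+1))]
    simp only [hA, Finset.card_empty] at *
    omega
  · intro v
    rw [hsum, ← h.content v, total_count T (l 0) L hW hLT]

theorem finite_LR (l m n : ℕ → ℕ) (hl : IsPartition l) : Finite {T : ℕ → ℕ → ℕ // IsLR l m n T} := by
  obtain ⟨N, hN⟩ := hl.2
  let f : {T : ℕ → ℕ → ℕ // IsLR l m n T} → (Fin N × Fin (l 0) → Fin (N + 1)) :=
    fun T p => ⟨T.1 p.1 p.2, by have := T.2.le_row hl.1 p.1 p.2; omega⟩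
  apply Finite.of_injective f
  rintro ⟨T, hT⟩ ⟨S, hS⟩ h
  apply Subtype.ext
  funext r c
  simp only
  by_cases hc : InSkew l m (r, c)
  · have h1 : c < l r := hc.2
    have h2 := hl.1 (Nat.zero_le r)
    have h3 : r < N := by
      by_contra h3
      have := hN r (by omega)
      omega
    have := congrFun h (⟨r, h3⟩, ⟨c, by omega⟩)
    simpa [f] using this
  · have h1 := mt (hT.support (r, c)).1 hc
    have h2 := mt (hS.support (r, c)).1 hc
    simp only [ne_eq, not_not] at h1 h2
    rw [h1, h2]

theorem LR_ne_zero (l m n : ℕ → ℕ) (hl : IsPartition l) : LR l m n ≠ 0 ↔ ∃ T, IsLR l m n T := by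
  have := finite_LR l m n hl
  unfold LR
  rw [← Nat.pos_iff_ne_zero, Nat.card_pos_iff]
  simp [this, nonempty_subtype]

end ext

/-- integer hives on the triangle `x + y + z = L`, in the cyclically symmetric normalisation -/
structure HiveT (k : ℤ) (L : ℕ) (m n c : ℕ → ℕ) (F : ℕ → ℕ → ℕ → ℤ) : Prop where
  ra : ∀ x y z, x + y + z + 2 = L →
    F x (y + 2) z + F (x + 1) y (z + 1) ≤ F (x + 1) (y + 1) z + F x (y + 1) (z + 1)
  rb : ∀ x y z, x + y + z + 2 = L →
    F x y (z + 2) + F (x + 1) (y + 1) z ≤ F x (y + 1) (z + 1) + F (x + 1) y (z + 1)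
  rc : ∀ x y z, x + y + z + 2 = L →
    F (x + 2) y z + F x (y + 1) (z + 1) ≤ F (x + 1) (y + 1) z + F (x + 1) y (z + 1)
  em : ∀ y z, y + z + 1 = L → F 0 (y + 1) z = F 0 y (z + 1) + m y
  en : ∀ x y, x + y + 1 = L → F (x + 1) y 0 = F x (y + 1) 0 + n x
  ec : ∀ x z, x + z + 1 = L → F x 0 (z + 1) = F (x + 1) 0 z + c z - k

theorem HiveT.rot {k : ℤ} {L : ℕ} {m n c : ℕ → ℕ} {F : ℕ → ℕ → ℕ → ℤ} (h : HiveT k L m n c F) :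
    HiveT k L n c m (fun x y z => F y z x + k * x) := by
  refine ⟨?_, ?_, ?_, ?_, ?_, ?_⟩
  · intro x y z hh
    have := h.rc y z x (by omega)
    push_cast
    linarith
  · intro x y z hh
    have := h.ra y z x (by omega)
    push_cast
    linarith
  · intro x y z hh
    have := h.rb y z x (by omega)
    push_cast
    linarith
  · intro y z hh
    have := h.en y z (by omega)
    push_cast
    linarith
  · intro x y hh
    have := h.ec y x (by omega)
    push_cast
    linarith
  · intro x z hh
    have := h.em z x (by omega)
    push_cast
    linarith

theorem Pat.toHive {L : ℕ} {l m n c : ℕ → ℕ} {P : ℕ → ℕ → ℕ} (h : Pat L l m n P) (k : ℤ)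
    (hlc : ∀ x z, x + z + 1 = L → (l x : ℤ) = k - c z) : ∃ F, HiveT k L m n c F := by
  refine ⟨fun x y _ => ∑ s ∈ Finset.range (x + y), (P s x : ℤ), ?_, ?_, ?_, ?_, ?_, ?_⟩
  · intro x y z hh
    have h1 := h.mono (x+y+1) x
    simp only [show x + (y + 2) = x + y + 1 + 1 by omega, show x + 1 + y = x + y + 1 by omega,
      show x + 1 + (y + 1) = x + y + 1 + 1 by omega, show x + (y + 1) = x + y + 1 by omega,
      Finset.sum_range_succ _ (x + y + 1)]
    linarith [(Nat.cast_le (α := ℤ)).2 h1]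
  · intro x y z hh
    have h1 := h.inter (x+y) x
    simp only [show x + 1 + y = x + y + 1 by omega,
      show x + 1 + (y + 1) = x + y + 1 + 1 by omega, show x + (y + 1) = x + y + 1 by omega]
    rw [Finset.sum_range_succ _ (x+y+1), Finset.sum_range_succ (fun s => (P s x : ℤ))]
    linarith [(Nat.cast_le (α := ℤ)).2 h1]
  · intro x y z hh
    have h1 := (Nat.cast_le (α := ℤ)).2 (h.latt (x+y+1) x)
    push_cast at h1
    simp only [show x + 2 + y = x + y + 1 + 1 by omega, show x + 1 + y = x + y + 1 by omega,
      show x + 1 + (y + 1) = x + y + 1 + 1 by omega, show x + (y + 1) = x + y + 1 by omega]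
    linarith
  · intro y z hh
    simp only [Nat.zero_add, Finset.sum_range_succ, h.zero]
  · intro x y hh
    have h1 := congrArg (Nat.cast (R := ℤ)) (h.cont x)
    push_cast at h1
    simp only [show x + 1 + y = L by omega, show x + (y + 1) = L by omega]
    exact h1
  · intro x z hh
    have h1 : ∑ s ∈ Finset.range x, (P s x : ℤ) = ∑ s ∈ Finset.range x, (P s (x+1) : ℤ) := by
      apply Finset.sum_congr rfl
      intro s hs
      have := Finset.mem_range.1 hs
      rw [h.top s x (by omega), h.top s (x+1) (by omega)]
    simp only [Nat.add_zero, Finset.sum_range_succ]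
    rw [h1, h.top x (x+1) (by omega), hlc x z hh]
    ring

theorem HiveT.toPat {k : ℤ} {L : ℕ} {l m n c : ℕ → ℕ} {F : ℕ → ℕ → ℕ → ℤ}
    (h : HiveT k L m n c F) (hlc : ∀ x z, x + z + 1 = L → (l x : ℤ) = k - c z)
    (hl : ∀ ⦃i j : ℕ⦄, i ≤ j → l j ≤ l i) (hlz : ∀ r, L ≤ r → l r = 0)
    (hmz : ∀ r, L ≤ r → m r = 0)
    (hn : ∀ ⦃i j : ℕ⦄, i ≤ j → n j ≤ n i) (hnz : ∀ r, L ≤ r → n r = 0) :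
    ∃ P, Pat L l m n P := by
  set Q : ℕ → ℕ → ℤ := fun r v => if r < v then (l r : ℤ) else if r < L then
    F v (r + 1 - v) (L - r - 1) - F v (r - v) (L - r) else 0 with hQdef
  have hQ : ∀ v y z, v + y + z + 1 = L → Q (v + y) v = F v (y + 1) z - F v y (z + 1) := by
    intro v y z hh
    simp only [hQdef]
    rw [if_neg (by omega), if_pos (by omega), show v + y + 1 - v = y + 1 by omega,
      show L - (v + y) - 1 = z by omega, show v + y - v = y by omega,
      show L - (v + y) = z + 1 by omega]
  have hQt : ∀ r v, r < v → Q r v = l r := by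
    intro r v hh
    simp only [hQdef]
    rw [if_pos hh]
  have hQz : ∀ r v, L ≤ r → Q r v = 0 := by
    intro r v hh
    simp only [hQdef]
    split_ifs
    · simp [hlz r hh]
    · omega
    · rfl
  have hQ0 : ∀ r, Q r 0 = m r := by
    intro r
    by_cases hr : r < L
    · have h1 := hQ 0 r (L - r - 1) (by omega)
      have h2 := h.em r (L - r - 1) (by omega)
      rw [Nat.zero_add] at h1
      rw [h1, h2]
      ring
    · rw [hQz r 0 (by omega), hmz r (by omega)]
      rfl
  have hle : ∀ x z, x + z + 1 = L → F (x + 1) 0 z = F x 0 (z + 1) + l x := by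
    intro x z hh
    have := h.ec x z hh
    have := hlc x z hh
    linarith
  -- the diagonal numbers are nonnegative
  have hD : ∀ z x, x + z + 1 = L → F x 1 z ≤ F (x + 1) 0 z := by
    intro z
    induction z with
    | zero =>
      intro x hh
      have := h.en x 0 (by omega)
      simp only [Nat.zero_add] at this
      rw [this]
      have : (0 : ℤ) ≤ n x := Int.natCast_nonneg _
      linarith
    | succ z ih =>
      intro x hh
      have h1 := ih (x+1) (by omega)
      have h2 := h.rc x 0 z (by omega)
      simp only [Nat.zero_add] at h2
      have h3 : x + 1 + 1 = x + 2 := rfl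
      rw [h3] at h1
      linarith
  have hQm : ∀ r v, Q r v ≤ Q r (v + 1) := by
    intro r v
    by_cases hr : r < L
    · rcases Nat.lt_trichotomy r v with h1 | h1 | h1
      · rw [hQt r v h1, hQt r (v+1) (by omega)]
      · subst h1
        rw [hQt r (r+1) (by omega)]
        have h1 := hQ r 0 (L - r - 1) (by omega)
        have h2 := hD (L - r - 1) r (by omega)
        have h3 := hle r (L - r - 1) (by omega)
        simp only [Nat.zero_add, Nat.add_zero] at h1
        rw [h1]
        linarith
      · obtain ⟨y, rfl⟩ : ∃ y, r = v + y + 1 := ⟨r - v - 1, by omega⟩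
        obtain ⟨z, hz⟩ : ∃ z, v + y + z + 2 = L := ⟨L - 2 - v - y, by omega⟩
        have h2 := hQ v (y+1) z (by omega)
        have h3 := hQ (v+1) y z (by omega)
        rw [show v + (y + 1) = v + y + 1 by omega] at h2
        rw [show v + 1 + y = v + y + 1 by omega] at h3
        have h4 := h.ra v y z (by omega)
        rw [h2, h3]
        have h3 : y + 1 + 1 = y + 2 := rfl
        rw [h3]
        linarith
    · rw [hQz r v (by omega), hQz r (v+1) (by omega)]
  have hQn : ∀ r v, 0 ≤ Q r v := by
    intro r v
    have h1 := monotone_nat_of_le_succ (hQm r) (Nat.zero_le v)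
    rw [hQ0] at h1
    have : (0 : ℤ) ≤ m r := Int.natCast_nonneg _
    linarith
  have hQi : ∀ r v, Q (r + 1) (v + 1) ≤ Q r v := by
    intro r v
    by_cases hr : r + 1 < L
    · by_cases h1 : r < v
      · rw [hQt r v h1, hQt (r+1) (v+1) (by omega)]
        exact_mod_cast hl (Nat.le_succ r)
      · obtain ⟨y, rfl⟩ : ∃ y, r = v + y := ⟨r - v, by omega⟩
        obtain ⟨z, hz⟩ : ∃ z, v + y + z + 2 = L := ⟨L - 2 - v - y, by omega⟩
        have h2 := hQ v y (z+1) (by omega)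
        have h3 := hQ (v+1) y z (by omega)
        rw [show v + 1 + y = v + y + 1 by omega] at h3
        have h4 := h.rb v y z (by omega)
        rw [h2, h3]
        have h3 : z + 1 + 1 = z + 2 := rfl
        rw [h3]
        linarith
    · rw [hQz (r+1) (v+1) (by omega)]
      exact hQn _ _
  have hSd : ∀ R v, R ≤ v → R ≤ L → ∑ s ∈ Finset.range R, Q s v = F R 0 (L - R) - F 0 0 L := by
    intro R v
    induction R with
    | zero => intro _ _; simp
    | succ R ih =>
      intro h1 h2
      rw [Finset.sum_range_succ, ih (by omega) (by omega), hQt R v (by omega)]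
      have := hle R (L - (R+1)) (by omega)
      rw [this, show L - R = L - (R+1) + 1 by omega]
      ring
  have hS : ∀ v y z, v + y + z = L → ∑ s ∈ Finset.range (v + y), Q s v = F v y z - F 0 0 L := by
    intro v y
    induction y with
    | zero =>
      intro z hz
      have := hSd v v le_rfl (by omega)
      rw [Nat.add_zero, this, show L - v = z by omega]
    | succ y ih =>
      intro z hz
      rw [show v + (y + 1) = v + y + 1 by omega, Finset.sum_range_succ, ih (z+1) (by omega),
        hQ v y z (by omega)]
      ring
  have hcont : ∀ v, ∑ s ∈ Finset.range L, Q s (v + 1) = ∑ s ∈ Finset.range L, Q s v + n v := by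
    intro v
    by_cases hv : v < L
    · obtain ⟨y, hy⟩ : ∃ y, v + y + 1 = L := ⟨L - v - 1, by omega⟩
      have h1 := hS v (y+1) 0 (by omega)
      have h2 := hS (v+1) y 0 (by omega)
      rw [show v + (y + 1) = L by omega] at h1
      rw [show v + 1 + y = L by omega] at h2
      rw [h1, h2, h.en v y hy]
      ring
    · rw [hSd L v (by omega) le_rfl, hSd L (v+1) (by omega) le_rfl, hnz v (by omega)]
      simp
  have hext : ∀ i v, L ≤ i → ∑ s ∈ Finset.range i, Q s v = ∑ s ∈ Finset.range L, Q s v := by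
    intro i v hi
    symm
    apply Finset.sum_subset
    · intro s
      simp only [Finset.mem_range]
      omega
    · intro s _ hs
      rw [Finset.mem_range] at hs
      exact hQz s v (by omega)
  have hlatt : ∀ i v, ∑ s ∈ Finset.range (i + 1), Q s (v + 2) + ∑ s ∈ Finset.range i, Q s v ≤
      ∑ s ∈ Finset.range (i + 1), Q s (v + 1) + ∑ s ∈ Finset.range i, Q s (v + 1) := by
    intro i v
    by_cases hi : L ≤ i
    · rw [hext i v hi, hext i (v+1) hi, hext (i+1) (v+1) (by omega), hext (i+1) (v+2) (by omega)]
      have h1 := hcont v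
      have h2 := hcont (v+1)
      have h3 : (n (v+1) : ℤ) ≤ n v := by exact_mod_cast hn (Nat.le_succ v)
      rw [show v + 1 + 1 = v + 2 from rfl] at h2
      linarith
    · by_cases hv : i ≤ v
      · rw [hSd (i+1) (v+2) (by omega) (by omega), hSd (i+1) (v+1) (by omega) (by omega),
          hSd i v hv (by omega), hSd i (v+1) (by omega) (by omega)]
      · obtain ⟨y, rfl⟩ : ∃ y, i = v + y + 1 := ⟨i - v - 1, by omega⟩
        obtain ⟨z, hz⟩ : ∃ z, v + y + z + 2 = L := ⟨L - 2 - v - y, by omega⟩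
        have h1 := hS (v+2) y z (by omega)
        have h2 := hS v (y+1) (z+1) (by omega)
        have h3 := hS (v+1) (y+1) z (by omega)
        have h4 := hS (v+1) y (z+1) (by omega)
        rw [show v + 2 + y = v + y + 1 + 1 by omega] at h1
        rw [show v + (y + 1) = v + y + 1 by omega] at h2
        rw [show v + 1 + (y + 1) = v + y + 1 + 1 by omega] at h3
        rw [show v + 1 + y = v + y + 1 by omega] at h4
        rw [h1, h2, h3, h4]
        linarith [h.rc v y z hz]
  have hc : ∀ r v, ((Q r v).toNat : ℤ) = Q r v := fun r v => Int.toNat_of_nonneg (hQn r v)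
  refine ⟨fun r v => (Q r v).toNat, ?_, ?_, ?_, ?_, ?_, ?_, hlz⟩
  · intro r
    zify
    rw [hc, hQ0]
  · intro r v hv
    zify
    rw [hc, hQt r v hv]
  · intro r v
    zify
    rw [hc, hc]
    exact hQm r v
  · intro r v
    zify
    rw [hc, hc]
    exact hQi r v
  · intro i v
    zify
    simp only [hc]
    exact hlatt i v
  · intro v
    zify
    simp only [hc]
    exact hcont v

theorem pat_add (L : ℕ) (m n : ℕ → ℕ) (hm : ∀ ⦃i j : ℕ⦄, i ≤ j → m j ≤ m i)
    (hn : ∀ ⦃i j : ℕ⦄, i ≤ j → n j ≤ n i) (hmz : ∀ r, L ≤ r → m r = 0)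
    (hnz : ∀ r, L ≤ r → n r = 0) :
    Pat L (fun r => m r + n r) m n (fun r v => m r + if r < v then n r else 0) := by
  have hs : ∀ i v, ∑ s ∈ Finset.range i, (m s + if s < v + 1 then n s else 0) =
      ∑ s ∈ Finset.range i, (m s + if s < v then n s else 0) + if v < i then n v else 0 := by
    intro i v
    induction i with
    | zero => simp
    | succ i ih =>
      rw [Finset.sum_range_succ, Finset.sum_range_succ, ih]
      rcases Nat.lt_trichotomy i v with h | h | h
      · simp [h, show i < v + 1 by omega, show ¬ v < i by omega, show ¬ v < i + 1 by omega]
      · subst h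
        simp
        omega
      · simp [h, show ¬ i < v + 1 by omega, show ¬ i < v by omega, show v < i + 1 by omega]
        omega
  refine ⟨?_, ?_, ?_, ?_, ?_, ?_, ?_⟩
  · intro r; simp
  · intro r v hv; simp [hv]
  · intro r v
    split_ifs <;> omega
  · intro r v
    have := hm (Nat.le_succ r)
    have := hn (Nat.le_succ r)
    simp only [Nat.succ_eq_add_one] at *
    split_ifs <;> omega
  · intro i v
    have h1 := hs (i+1) (v+1)
    have h2 := hs i v
    have := hn (Nat.le_succ v)
    simp only [Nat.succ_eq_add_one, show v + 1 + 1 = v + 2 from rfl] at *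
    rw [h1, h2]
    split_ifs <;> omega
  · intro v
    rw [hs]
    split_ifs with h
    · rfl
    · rw [hnz v (by omega)]
  · intro r hr
    simp [hmz r hr, hnz r hr]

theorem Pat.sum_mono {N : ℕ} {l m n : ℕ → ℕ} {P : ℕ → ℕ → ℕ} (h : Pat N l m n P) (s v : ℕ)
    (hs : s < N) : P s (v + 1) ≤ P s v + n v := by
  have h1 := h.cont v
  rw [← Finset.add_sum_erase _ _ (Finset.mem_range.2 hs),
    ← Finset.add_sum_erase _ (fun s => P s v) (Finset.mem_range.2 hs)] at h1
  have h2 : ∑ x ∈ (Finset.range N).erase s, P x v ≤ ∑ x ∈ (Finset.range N).erase s, P x (v+1) :=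
    Finset.sum_le_sum (fun x _ => h.mono x v)
  omega

theorem Pat.length_le {N : ℕ} {l m n : ℕ → ℕ} {P : ℕ → ℕ → ℕ} (h : Pat N l m n P)
    (Lm Ln : ℕ) (hm : m Lm = 0) (hn : ∀ i, Ln ≤ i → n i = 0) : l (Lm + Ln) = 0 := by
  by_cases hN : N ≤ Lm + Ln
  · exact h.lz _ hN
  have h1 : ∀ d, P (Lm + Ln) (Ln + d) ≤ P (Lm + Ln) Ln := by
    intro d
    induction d with
    | zero => exact le_rfl
    | succ d ih =>
      have := h.sum_mono (Lm + Ln) (Ln + d) (by omega)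
      rw [hn _ (by omega)] at this
      rw [show Ln + (d + 1) = Ln + d + 1 by omega]
      omega
  have h2 : ∀ d, P (Lm + d) d ≤ m Lm := by
    intro d
    induction d with
    | zero => exact (h.zero _).le
    | succ d ih => exact (h.inter (Lm + d) d).trans ih
  have h3 := h1 (Lm + 1)
  rw [h.top _ _ (by omega)] at h3
  have := h2 Ln
  omega

theorem Pat.content_le {L : ℕ} {l m n : ℕ → ℕ} {P : ℕ → ℕ → ℕ} (h : Pat L l m n P) :
    n 0 ≤ l 0 := by
  have h1 : ∀ R, ∑ s ∈ Finset.range R, P s 1 ≤ l 0 + ∑ s ∈ Finset.range R, P s 0 := by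
    have h2 : ∀ R, ∑ s ∈ Finset.range (R+1), P s 1 ≤ l 0 + ∑ s ∈ Finset.range R, P s 0 := by
      intro R
      induction R with
      | zero => simp [h.top 0 1]
      | succ R ih =>
        rw [Finset.sum_range_succ, Finset.sum_range_succ (fun s => P s 0)]
        have := h.inter R 0
        simp only [Nat.zero_add] at this
        omega
    intro R
    cases R with
    | zero => simp
    | succ R =>
      have := h2 R
      rw [Finset.sum_range_succ (fun s => P s 0)]
      omega
  have h2 := h.cont 0
  have h3 := h1 L
  simp only [Nat.zero_add] at h2
  omega

theorem rotCompl_part (k L : ℕ) (f : ℕ → ℕ) (hf : ∀ ⦃i j : ℕ⦄, i ≤ j → f j ≤ f i) :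
    IsPartition (RotCompl k L f) := by
  refine ⟨?_, L, ?_⟩
  · intro i j hij
    unfold RotCompl
    have := hf (show L - 1 - j ≤ L - 1 - i by omega)
    split_ifs <;> omega
  · intro i hi
    unfold RotCompl
    rw [if_neg (by omega)]

theorem rotCompl_zero (k L : ℕ) (f : ℕ → ℕ) (r : ℕ) (hr : L ≤ r) : RotCompl k L f r = 0 := by
  unfold RotCompl
  rw [if_neg (by omega)]

theorem rotCompl_cast (k L : ℕ) (f : ℕ → ℕ) (hf : ∀ z, f z ≤ k) (x z : ℕ) (h : x + z + 1 = L) :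
    (RotCompl k L f x : ℤ) = (k : ℤ) - f z := by
  unfold RotCompl
  rw [if_pos (by omega), show L - 1 - x = z by omega, Nat.cast_sub (hf z)]

/-- forward direction -/
theorem fwd (m n : ℕ → ℕ) (hm : IsPartition m) (hn : IsPartition n)
    (Lm Ln : ℕ) (hLm : ∀ i, Lm ≤ i → m i = 0) (hLn : ∀ i, Ln ≤ i → n i = 0)
    (e : ℕ → ℕ) (he : IsPartition e) (h : LR e m n ≠ 0) :
    ∃ c, IsPartition c ∧ LR (RotCompl (m 0 + n 0) (Lm + Ln) m) n c ≠ 0 ∧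
      ∀ i, i < Lm + Ln → e i ≤ m 0 + n 0 ∧ c (Lm + Ln - 1 - i) ≤ m 0 + n 0 - e i := by
  obtain ⟨T, hT⟩ := (LR_ne_zero e m n he).1 h
  set E : ℕ → ℕ := fun i => max (e i) (m i) with hE
  have hEanti : ∀ ⦃i j : ℕ⦄, i ≤ j → E j ≤ E i := fun i j hij => max_le_max (he.1 hij) (hm.1 hij)
  have hsk : ∀ p, InSkew E m p ↔ InSkew e m p := by
    intro p
    simp only [InSkew, hE]
    omega
  have hT' : IsLR E m n T := by
    refine ⟨?_, ?_, ?_, hT.content, hT.lattice⟩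
    · intro p; rw [hsk]; exact hT.support p
    · intro i j h1 h2
      rw [hsk] at h1 h2
      exact hT.row_weak i j h1 h2
    · intro i j h1 h2
      rw [hsk] at h1 h2
      exact hT.col_strict i j h1 h2
  obtain ⟨N, hN⟩ := he.2
  have hEN : ∀ r, max (N + 1) (Lm + Ln + 1) ≤ r → E r = 0 := by
    intro r hr
    have h1 := hN r (by omega)
    have h2 := hLm r (by omega)
    simp only [hE, h1, h2]
    rfl
  have hmE : ∀ r, m r ≤ E r := fun r => le_max_right _ _
  obtain ⟨P, hP⟩ := hT'.toPat hEanti hm.1 hmE _ hEN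
  have hEL0 := hP.length_le Lm Ln (hLm _ le_rfl) hLn
  have hEL : ∀ r, Lm + Ln ≤ r → E r = 0 := by
    intro r hr
    have := hEanti hr
    omega
  have hE0 : E 0 ≤ m 0 + n 0 := by
    have h1 := hP.sum_mono 0 0 (by omega)
    rw [hP.top 0 _ (by omega), hP.zero] at h1
    exact h1
  have hEk : ∀ r, E r ≤ m 0 + n 0 := fun r => (hEanti (Nat.zero_le r)).trans hE0
  obtain ⟨P', hP'⟩ := hT'.toPat hEanti hm.1 hmE _ hEL
  set k := m 0 + n 0 with hk
  set L := Lm + Ln with hL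
  have hc := rotCompl_part k L E hEanti
  obtain ⟨F, hF⟩ := hP'.toHive (c := RotCompl k L E) (k : ℤ) (by
    intro x z hxz
    have := rotCompl_cast k L E hEk z x (by omega)
    omega)
  have hmp := rotCompl_part k L m hm.1
  obtain ⟨R, hR⟩ := hF.rot.toPat (l := RotCompl k L m)
    (rotCompl_cast k L m (fun z => (hm.1 (Nat.zero_le z)).trans (by omega)))
    hmp.1 (rotCompl_zero k L m) (fun r hr => hLn r (by omega)) hc.1 (rotCompl_zero k L E)
  refine ⟨RotCompl k L E, hc, (LR_ne_zero _ _ _ hmp).2 ⟨_, hR.isLR hmp.1⟩, ?_⟩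
  intro i hi
  have h1 : e i ≤ E i := le_max_left _ _
  have h2 := hEk i
  refine ⟨by omega, ?_⟩
  unfold RotCompl
  rw [if_pos (by omega), show L - 1 - (L - 1 - i) = i by omega]
  omega

/-- backward direction -/
theorem bwd (m n : ℕ → ℕ) (hm : IsPartition m) (hn : IsPartition n)
    (Lm Ln : ℕ) (hLm : ∀ i, Lm ≤ i → m i = 0) (hLn : ∀ i, Ln ≤ i → n i = 0)
    (c : ℕ → ℕ) (hc : IsPartition c) (h : LR (RotCompl (m 0 + n 0) (Lm + Ln) m) n c ≠ 0) :
    ∃ e, IsPartition e ∧ LR e m n ≠ 0 ∧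
      ∀ i, i < Lm + Ln → e i = m 0 + n 0 - c (Lm + Ln - 1 - i) := by
  set k := m 0 + n 0 with hk
  set L := Lm + Ln with hL
  have hmp := rotCompl_part k L m hm.1
  have hmk : ∀ z, m z ≤ k := fun z => (hm.1 (Nat.zero_le z)).trans (by omega)
  obtain ⟨T, hT⟩ := (LR_ne_zero _ _ _ hmp).1 h
  obtain ⟨P, hP⟩ := hT.toPat hmp.1 hn.1 (by
    intro r
    unfold RotCompl
    have h1 := hn.1 (Nat.zero_le r)
    split_ifs with hr
    · by_cases h2 : Ln ≤ r
      · rw [hLn r h2]; omega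
      · rw [hLm (L - 1 - r) (by omega)]; omega
    · rw [hLn r (by omega)]) L (rotCompl_zero k L m)
  have hck : ∀ z, c z ≤ k := by
    intro z
    have h1 := hP.content_le
    have h2 := hc.1 (Nat.zero_le z)
    have h3 : RotCompl k L m 0 ≤ k := by
      unfold RotCompl
      split_ifs <;> omega
    omega
  obtain ⟨F, hF⟩ := hP.toHive (c := m) (k : ℤ) (rotCompl_cast k L m hmk)
  have hcp := rotCompl_part k L c hc.1
  obtain ⟨R, hR⟩ := hF.rot.rot.toPat (l := RotCompl k L c) (rotCompl_cast k L c hck)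
    hcp.1 (rotCompl_zero k L c) (fun r hr => hLm r (by omega)) hn.1 (fun r hr => hLn r (by omega))
  refine ⟨RotCompl k L c, hcp, (LR_ne_zero _ _ _ hcp).2 ⟨_, hR.isLR hcp.1⟩, ?_⟩
  intro i hi
  unfold RotCompl
  rw [if_pos hi]

/-- With `k = m₁ + n₁` and `L = length m + length n`, the cover partition of
the ordinary product `[m] ⊗ [n]` (componentwise maximum of all `e` with
`c(e; m, n) ≠ 0`) is the 180°-rotated complement in `(k^L)` of the base
partition of the skew character of `A = (((k^L)/m)°)/n`. -/
theorem stmt12 (m n : ℕ → ℕ) (hm : IsPartition m) (hn : IsPartition n)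
    (Lm Ln : ℕ) (hLm : ∀ i, m i ≠ 0 ↔ i < Lm) (hLn : ∀ i, n i ≠ 0 ↔ i < Ln) :
    ∀ i, i < Lm + Ln →
      sSup {x | ∃ e, IsPartition e ∧ LR e m n ≠ 0 ∧ e i = x} =
        (m 0 + n 0) -
          sInf {x | ∃ c, IsPartition c ∧
            LR (RotCompl (m 0 + n 0) (Lm + Ln) m) n c ≠ 0 ∧
            c (Lm + Ln - 1 - i) = x} := by
  intro i hi
  have hLm' : ∀ i, Lm ≤ i → m i = 0 := by
    intro j hj
    by_contra hc
    have := (hLm j).1 hc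
    omega
  have hLn' : ∀ i, Ln ≤ i → n i = 0 := by
    intro j hj
    by_contra hc
    have := (hLn j).1 hc
    omega
  have hF := fwd m n hm hn Lm Ln hLm' hLn'
  have hB := bwd m n hm hn Lm Ln hLm' hLn'
  have hpart : IsPartition (fun r => m r + n r) :=
    ⟨fun a b hab => Nat.add_le_add (hm.1 hab) (hn.1 hab), Lm + Ln, fun r hr => by
      simp [hLm' r (by omega), hLn' r (by omega)]⟩
  have hne : LR (fun r => m r + n r) m n ≠ 0 :=
    (LR_ne_zero _ _ _ hpart).2 ⟨_, (pat_add (Lm + Ln) m n hm.1 hn.1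
      (fun r hr => hLm' r (by omega)) (fun r hr => hLn' r (by omega))).isLR hpart.1⟩
  obtain ⟨c₁, hc₁, hc₂, -⟩ := hF _ hpart hne
  have hmem := Nat.sInf_mem (s := {x | ∃ c, IsPartition c ∧
            LR (RotCompl (m 0 + n 0) (Lm + Ln) m) n c ≠ 0 ∧
            c (Lm + Ln - 1 - i) = x}) ⟨_, c₁, hc₁, hc₂, rfl⟩
  have hle : ∀ x ∈ {x | ∃ e, IsPartition e ∧ LR e m n ≠ 0 ∧ e i = x}, x ≤ (m 0 + n 0) -
          sInf {x | ∃ c, IsPartition c ∧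
            LR (RotCompl (m 0 + n 0) (Lm + Ln) m) n c ≠ 0 ∧
            c (Lm + Ln - 1 - i) = x} := by
    rintro x ⟨e, he, h1, rfl⟩
    obtain ⟨c, hc, h2, h3⟩ := hF e he h1
    have h4 := h3 i hi
    have h5 := Nat.sInf_le (s := {x | ∃ c, IsPartition c ∧
            LR (RotCompl (m 0 + n 0) (Lm + Ln) m) n c ≠ 0 ∧
            c (Lm + Ln - 1 - i) = x}) ⟨c, hc, h2, rfl⟩
    omega
  apply le_antisymm
  · exact csSup_le' hle
  · obtain ⟨c, hc, h1, h2⟩ := hmem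
    obtain ⟨e, he, h3, h4⟩ := hB c hc h1
    rw [← h2, ← h4 i hi]
    exact le_csSup ⟨_, hle⟩ ⟨e, he, h3, rfl⟩
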